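/- arXiv:2210.10755 — 6 statements merged into one kernel-verified Lean document; each statement's English description precedes it below -/
import Mathlib

section
/- Every P5-free graph on n ≥ 1 vertices contains an induced cograph on at least 2^{(log n)^{2/3}/16} vertices. -/
open SimpleGraph

/-- A set of vertices is homogeneous if it induces a clique or an independent set. -/
def IsHomogeneous {V : Type*} (G : SimpleGraph V) (s : Finset V) : Prop :=
  G.IsClique (s : Set V) ∨ Gᶜ.IsClique (s : Set V)

/-- `hom(G)`: the largest size of a homogeneous set in `G`. -/
noncomputable def homNum {V : Type*} (G : SimpleGraph V) : ℕ :=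
  sSup {k : ℕ | ∃ s : Finset V, IsHomogeneous G s ∧ s.card = k}

/-- `G` contains no induced copy of `H`. -/
def IndFree {W V : Type*} (H : SimpleGraph W) (G : SimpleGraph V) : Prop :=
  ¬ Nonempty (H ↪g G)

/-- `G` has no induced path on five vertices. -/
def P5Free {V : Type*} (G : SimpleGraph V) : Prop :=
  IndFree (pathGraph 5) G

/-- A set of vertices inducing a cograph, i.e. a graph with no induced path on 4 vertices. -/
def IsCographSet {V : Type*} (G : SimpleGraph V) (s : Finset V) : Prop :=
  IndFree (pathGraph 4) (G.induce (s : Set V))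

section aux
open scoped Classical

variable {V : Type}

def P5E (G : SimpleGraph V) : Prop := ∀ a b c d e : V, G.Adj a b → G.Adj b c → G.Adj c d → G.Adj d e →
  ¬ G.Adj a c → ¬ G.Adj a d → ¬ G.Adj a e → ¬ G.Adj b d → ¬ G.Adj b e → ¬ G.Adj c e → False

def P4E (G : SimpleGraph V) (s : Finset V) : Prop := ∀ a ∈ s, ∀ b ∈ s, ∀ c ∈ s, ∀ d ∈ s,
  G.Adj a b → G.Adj b c → G.Adj c d → ¬ G.Adj a c → ¬ G.Adj a d → ¬ G.Adj b d → False

lemma p5e_of_free (G : SimpleGraph V) (h : P5Free G) : P5E G := by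
  intro a b c d e hab hbc hcd hde hac had hae hbd hbe hce
  apply h
  have n1 : a ≠ b := hab.ne
  have n2 : b ≠ c := hbc.ne
  have n3 : c ≠ d := hcd.ne
  have n4 : d ≠ e := hde.ne
  have n5 : a ≠ c := by rintro rfl; exact had hcd
  have n6 : a ≠ d := by rintro rfl; exact hac hcd.symm
  have n7 : a ≠ e := by rintro rfl; exact had hde.symm
  have n8 : b ≠ d := by rintro rfl; exact hbe hde
  have n9 : b ≠ e := by rintro rfl; exact hbd hde.symm
  have n10 : c ≠ e := by rintro rfl; exact hbe hbc
  refine ⟨⟨⟨![a,b,c,d,e], ?_⟩, ?_⟩⟩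
  · intro i j hij
    fin_cases i <;> fin_cases j <;> simp_all
  · intro i j
    have s1 := hab.symm
    have s2 := hbc.symm
    have s3 := hcd.symm
    have s4 := hde.symm
    have s5 := fun h => hac (G.adj_symm h)
    have s6 := fun h => had (G.adj_symm h)
    have s7 := fun h => hae (G.adj_symm h)
    have s8 := fun h => hbd (G.adj_symm h)
    have s9 := fun h => hbe (G.adj_symm h)
    have s10 := fun h => hce (G.adj_symm h)
    fin_cases i <;> fin_cases j <;> simp [pathGraph_adj] <;> assumption

lemma cog_of_p4e (G : SimpleGraph V) (s : Finset V) (h : P4E G s) : IsCographSet G s := by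
  rintro ⟨f⟩
  have e := fun i j => f.map_rel_iff (a := i) (b := j)
  simp only [SimpleGraph.comap_adj, Function.Embedding.subtype_apply, SimpleGraph.induce] at e
  refine h (f 0) (f 0).2 (f 1) (f 1).2 (f 2) (f 2).2 (f 3) (f 3).2 ((e 0 1).2 ?_) ((e 1 2).2 ?_) ((e 2 3).2 ?_)
    (fun h => ?_) (fun h => ?_) (fun h => ?_)
  · simp [pathGraph_adj]
  · simp [pathGraph_adj]
  · simp [pathGraph_adj]
  · have := (e 0 2).1 h; simp [pathGraph_adj] at this
  · have := (e 0 3).1 h; simp [pathGraph_adj] at this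
  · have := (e 1 3).1 h; simp [pathGraph_adj] at this

def Comp (G : SimpleGraph V) (A B : Finset V) : Prop := ∀ a ∈ A, ∀ b ∈ B, G.Adj a b
def Anti (G : SimpleGraph V) (A B : Finset V) : Prop := ∀ a ∈ A, ∀ b ∈ B, ¬ G.Adj a b

def Wt (G : SimpleGraph V) (Y : Finset V) (j : ℕ) : Prop := ∃ F ⊆ Y, P4E G F ∧ j ≤ F.card

lemma Wt.mono {G : SimpleGraph V} {Y Z : Finset V} {j : ℕ} (h : Wt G Y j) (hs : Y ⊆ Z) : Wt G Z j := by
  obtain ⟨F, h1, h2⟩ := h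
  exact ⟨F, h1.trans hs, h2⟩

lemma p4e_union {G : SimpleGraph V} {A B : Finset V} (hA : P4E G A) (hB : P4E G B)
    (h : Comp G A B ∨ Anti G A B) : P4E G (A ∪ B) := by
  intro a ha b hb c hc d hd hab hbc hcd hac had hbd
  simp only [Finset.mem_union] at ha hb hc hd
  rcases h with h | h
  · have h' : ∀ b ∈ B, ∀ a ∈ A, G.Adj b a := fun b hb a ha => (h a ha b hb).symm
    rcases ha with ha | ha
    · have hc' : c ∈ A := hc.resolve_right fun x => hac (h a ha c x)
      have hd' : d ∈ A := hd.resolve_right fun x => had (h a ha d x)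
      have hb' : b ∈ A := hb.resolve_right fun x => hbd (h' b x d hd')
      exact hA a ha b hb' c hc' d hd' hab hbc hcd hac had hbd
    · have hc' : c ∈ B := hc.resolve_left fun x => hac (h' a ha c x)
      have hd' : d ∈ B := hd.resolve_left fun x => had (h' a ha d x)
      have hb' : b ∈ B := hb.resolve_left fun x => hbd (h b x d hd')
      exact hB a ha b hb' c hc' d hd' hab hbc hcd hac had hbd
  · have h' : ∀ b ∈ B, ∀ a ∈ A, ¬ G.Adj b a := fun b hb a ha x => (h a ha b hb) x.symm
    rcases ha with ha | ha
    · have hb' : b ∈ A := hb.resolve_right fun x => (h a ha b x) hab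
      have hc' : c ∈ A := hc.resolve_right fun x => (h b hb' c x) hbc
      have hd' : d ∈ A := hd.resolve_right fun x => (h c hc' d x) hcd
      exact hA a ha b hb' c hc' d hd' hab hbc hcd hac had hbd
    · have hb' : b ∈ B := hb.resolve_left fun x => (h' a ha b x) hab
      have hc' : c ∈ B := hc.resolve_left fun x => (h' b hb' c x) hbc
      have hd' : d ∈ B := hd.resolve_left fun x => (h' c hc' d x) hcd
      exact hB a ha b hb' c hc' d hd' hab hbc hcd hac had hbd

lemma comp_disj {G : SimpleGraph V} {A B : Finset V} (h : Comp G A B) : Disjoint A B :=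
  Finset.disjoint_left.2 fun a ha hb => G.loopless.irrefl a (h a ha a hb)

lemma Wt.add {G : SimpleGraph V} {A B : Finset V} {i j : ℕ} (hA : Wt G A i) (hB : Wt G B j)
    (hd : Disjoint A B) (h : Comp G A B ∨ Anti G A B) : Wt G (A ∪ B) (i + j) := by
  obtain ⟨F, h1, h2, h3⟩ := hA
  obtain ⟨E, g1, g2, g3⟩ := hB
  refine ⟨F ∪ E, Finset.union_subset_union h1 g1, p4e_union h2 g2 ?_, ?_⟩
  · rcases h with h | h
    · exact .inl fun a ha b hb => h a (h1 ha) b (g1 hb)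
    · exact .inr fun a ha b hb => h a (h1 ha) b (g1 hb)
  · rw [Finset.card_union_of_disjoint (Finset.disjoint_of_subset_left h1 (Finset.disjoint_of_subset_right g1 hd))]
    omega

def Conn (G : SimpleGraph V) (S : Finset V) : Prop :=
  ∀ P ⊆ S, P.Nonempty → P ≠ S → ∃ y ∈ P, ∃ z ∈ S, z ∉ P ∧ G.Adj y z

lemma pure_of_conn {G : SimpleGraph V} (hP : P5E G) {v b x : V} {S : Finset V} (hS : Conn G S)
    (hvb : G.Adj v b) (hv : ∀ s ∈ S, ¬ G.Adj v s) (hb : ∀ s ∈ S, ¬ G.Adj b s)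
    (hxb : G.Adj b x) (hxv : ¬ G.Adj v x) :
    (∀ s ∈ S, G.Adj x s) ∨ (∀ s ∈ S, ¬ G.Adj x s) := by
  by_contra! hcon
  obtain ⟨⟨s, hs, hs'⟩, ⟨u, hu, hu'⟩⟩ := hcon
  obtain ⟨y, hy, z, hz, hz', hyz⟩ := hS (S.filter (G.Adj x)) (Finset.filter_subset _ _)
    ⟨u, by simp [hu, hu']⟩ (fun h => by rw [← h] at hs; simp [hs'] at hs)
  simp only [Finset.mem_filter] at hy hz'
  exact hP v b x y z hvb hxb hy.2 hyz hxv (hv y hy.1) (hv z hz) (hb y hy.1) (hb z hz)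
    (fun h => hz' ⟨hz, h⟩)

noncomputable def nN (G : SimpleGraph V) (Y : Finset V) (v : V) : Finset V := Y.filter fun u => ¬ G.Adj v u
noncomputable def nb (G : SimpleGraph V) (Y : Finset V) (v : V) : Finset V := Y.filter fun u => G.Adj v u

lemma mem_nN {G : SimpleGraph V} {Y : Finset V} {v u : V} : u ∈ nN G Y v ↔ u ∈ Y ∧ ¬ G.Adj v u := by
  simp [nN]
lemma mem_nb {G : SimpleGraph V} {Y : Finset V} {v u : V} : u ∈ nb G Y v ↔ u ∈ Y ∧ G.Adj v u := by
  simp [nb]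
lemma nb_add_nN (G : SimpleGraph V) (Y : Finset V) (v : V) : (nb G Y v).card + (nN G Y v).card = Y.card :=
  Finset.card_filter_add_card_filter_not _
lemma nN_sub (G : SimpleGraph V) (Y : Finset V) (v : V) : nN G Y v ⊆ Y := Finset.filter_subset _ _
lemma nb_sub (G : SimpleGraph V) (Y : Finset V) (v : V) : nb G Y v ⊆ Y := Finset.filter_subset _ _
lemma nN_mono (G : SimpleGraph V) {Y Z : Finset V} (h : Y ⊆ Z) (v : V) : nN G Y v ⊆ nN G Z v :=
  Finset.filter_subset_filter _ h
lemma nb_mono (G : SimpleGraph V) {Y Z : Finset V} (h : Y ⊆ Z) (v : V) : nb G Y v ⊆ nb G Z v :=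
  Finset.filter_subset_filter _ h

def NoPure (G : SimpleGraph V) (X : Finset V) (m : ℕ) : Prop :=
  ∀ A ⊆ X, ∀ B ⊆ X, Disjoint A B → (Comp G A B ∨ Anti G A B) → m ≤ A.card → B.card < m

lemma giant {G : SimpleGraph V} {X Y : Finset V} {m : ℕ} (hno : NoPure G X m) (hY : Y ⊆ X)
    (hm : 1 ≤ m) (hc : 3 * m ≤ Y.card) :
    ∃ S ⊆ Y, Conn G S ∧ Y.card < S.card + m ∧ ∀ y ∈ S, ∀ z ∈ Y, z ∉ S → ¬ G.Adj y z := by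
  let Fam := Y.powerset.filter fun P => m ≤ P.card ∧ ∀ y ∈ P, ∀ z ∈ Y, z ∉ P → ¬ G.Adj y z
  have hne : Fam.Nonempty := ⟨Y, by
    simp only [Fam, Finset.mem_filter, Finset.mem_powerset]
    exact ⟨subset_rfl, by omega, fun y _ z hz hz' => absurd hz hz'⟩⟩
  obtain ⟨S, hS, hmin⟩ := Finset.exists_min_image Fam Finset.card hne
  simp only [Fam, Finset.mem_filter, Finset.mem_powerset] at hS hmin
  obtain ⟨hSY, hSm, hcl⟩ := hS
  have hbig : Y.card < S.card + m := by
    have := hno S (hSY.trans hY) (Y \ S) (Finset.sdiff_subset.trans hY) Finset.disjoint_sdiff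
      (.inr fun a ha b hb => by
        rw [Finset.mem_sdiff] at hb
        exact hcl a ha b hb.1 hb.2) hSm
    rw [Finset.card_sdiff_of_subset hSY] at this
    omega
  refine ⟨S, hSY, ?_, hbig, hcl⟩
  intro P hPS hPne hPS'
  by_contra! hcon
  have hlt : P.card < S.card := Finset.card_lt_card (hPS.ssubset_of_ne hPS')
  have h1 : P.card < m := by
    by_contra! hge
    have := hmin P ⟨hPS.trans hSY, hge, fun y hy z hz hzP => by
      by_cases hzS : z ∈ S
      · exact hcon y hy z hzS hzP
      · exact hcl y (hPS hy) z hz hzS⟩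
    omega
  have h2 : (S \ P).card < m := by
    by_contra! hge
    have hpos := hPne.card_pos
    have := hmin (S \ P) ⟨Finset.sdiff_subset.trans hSY, hge, fun y hy z hz hzP h => by
      rw [Finset.mem_sdiff] at hy hzP
      by_cases hzS : z ∈ S
      · have hz' : z ∈ P := by by_contra hh; exact hzP ⟨hzS, hh⟩
        exact hcon z hz' y hy.1 hy.2 h.symm
      · exact hcl y hy.1 z hz hzS h⟩
    rw [Finset.card_sdiff_of_subset hPS] at this
    omega
  rw [Finset.card_sdiff_of_subset hPS] at h2
  omega

lemma sparse {G : SimpleGraph V} (hP : P5E G) {X A : Finset V} {m Δ : ℕ} (hno : NoPure G X m)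
    (hm : 1 ≤ m) (hA : A ⊆ X) (hdeg : ∀ v ∈ A, (nb G A v).card ≤ Δ)
    (hc : 3 * Δ + 6 * m ≤ A.card) : False := by
  obtain ⟨S0, hS0, hS0c, hS0b, -⟩ := giant hno hA hm (by omega)
  obtain ⟨v, hv⟩ : S0.Nonempty := Finset.card_pos.1 (by omega)
  have hvA := hS0 hv
  have degS : ∀ (S : Finset V), S ⊆ A → ∀ v ∈ A, (nb G S v).card ≤ Δ := fun S hS v hv =>
    (Finset.card_le_card (nb_mono G hS v)).trans (hdeg v hv)
  have e1 := nb_add_nN G S0 v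
  have d1 := degS S0 hS0 v hvA
  have hY1 : ((nN G S0 v).erase v).card + 1 = (nN G S0 v).card :=
    Finset.card_erase_add_one (mem_nN.2 ⟨hv, G.loopless.irrefl v⟩)
  have hY1s : (nN G S0 v).erase v ⊆ S0 := (Finset.erase_subset _ _).trans (nN_sub _ _ _)
  obtain ⟨S1, hS1, hS1c, hS1b, hS1cl⟩ := giant hno (hY1s.trans (hS0.trans hA)) hm
    (by omega)
  have hS1S0 := hS1.trans hY1s
  have hvS1 : v ∉ S1 := fun h => by simpa using hS1 h
  obtain ⟨y, hy, b, hb, hb', hyb⟩ := hS0c S1 hS1S0 (Finset.card_pos.1 (by omega))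
    (fun h => hvS1 (h ▸ hv))
  have hvS : ∀ s ∈ S1, ¬ G.Adj v s := fun s hs => (mem_nN.1 (Finset.mem_of_mem_erase (hS1 hs))).2
  have hvb : G.Adj v b := by
    by_contra hn
    have : b ≠ v := by rintro rfl; exact hvS y hy hyb.symm
    exact hS1cl y hy b (Finset.mem_erase.2 ⟨this, mem_nN.2 ⟨hb, hn⟩⟩) hb' hyb
  have e2 := nb_add_nN G S1 b
  have d2 := degS S1 (hS1S0.trans hS0) b (hS0 hb)
  have hY2s : nN G S1 b ⊆ S1 := nN_sub _ _ _
  obtain ⟨S2, hS2, hS2c, hS2b, hS2cl⟩ := giant hno (hY2s.trans (hS1S0.trans (hS0.trans hA))) hm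
    (by omega)
  have hS2S1 := hS2.trans hY2s
  obtain ⟨y', hy', x, hx, hx', hyx⟩ := hS1c S2 hS2S1 (Finset.card_pos.1 (by omega))
    (fun h => (mem_nN.1 (hS2 (h ▸ hy))).2 hyb.symm)
  have hbx : G.Adj b x := by
    by_contra hn
    exact hS2cl y' hy' x (mem_nN.2 ⟨hx, hn⟩) hx' hyx
  have hxc : ∀ s ∈ S2, G.Adj x s :=
    (pure_of_conn hP hS2c hvb (fun s hs => hvS s (hS2S1 hs)) (fun s hs => (mem_nN.1 (hS2 hs)).2)
      hbx (hvS x hx)).resolve_right fun h => h y' hy' hyx.symm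
  have d3 := degS S2 (hS2S1.trans (hS1S0.trans hS0)) x (hS0 (hS1S0 hx))
  have : nb G S2 x = S2 := Finset.filter_true_of_mem hxc
  rw [this] at d3
  omega

def DenseIn (G : SimpleGraph V) (d : ℕ) (Z : Finset V) : Prop := ∀ z ∈ Z, d * (nN G Z z).card ≤ Z.card

lemma twins {G : SimpleGraph V} (hP : P5E G) {X : Finset V} {m : ℕ} (hno : NoPure G X m)
    (hm : 1 ≤ m) {v b : V} (hvb : G.Adj v b)
    (hc : 3 * m ≤ (nN G (nN G X v) b).card) : (nb G (nN G X v) b).card ≤ 2 * m := by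
  have hsub : nN G (nN G X v) b ⊆ X := (nN_sub _ _ _).trans (nN_sub _ _ _)
  obtain ⟨S, hS, hSc, hSb, -⟩ := giant hno hsub hm hc
  have hpure : ∀ x ∈ nb G (nN G X v) b, (∀ s ∈ S, G.Adj x s) ∨ (∀ s ∈ S, ¬ G.Adj x s) := by
    intro x hx
    rw [mem_nb, mem_nN] at hx
    exact pure_of_conn hP hSc hvb (fun s hs => (mem_nN.1 (mem_nN.1 (hS hs)).1).2)
      (fun s hs => (mem_nN.1 (hS hs)).2) hx.2 hx.1.2
  have hBX : nb G (nN G X v) b ⊆ X := (nb_sub _ _ _).trans (nN_sub _ _ _)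
  have hdis : Disjoint S (nb G (nN G X v) b) := Finset.disjoint_left.2 fun x hx hx' =>
    (mem_nN.1 (hS hx)).2 (mem_nb.1 hx').2
  have h1 := hno S (hS.trans hsub) ((nb G (nN G X v) b).filter fun x => ∀ s ∈ S, G.Adj x s)
    ((Finset.filter_subset _ _).trans hBX)
    (Finset.disjoint_of_subset_right (Finset.filter_subset _ _) hdis)
    (.inl fun a ha c hc => ((Finset.mem_filter.1 hc).2 a ha).symm) (by omega)
  have h2 := hno S (hS.trans hsub) ((nb G (nN G X v) b).filter fun x => ¬ ∀ s ∈ S, G.Adj x s)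
    ((Finset.filter_subset _ _).trans hBX)
    (Finset.disjoint_of_subset_right (Finset.filter_subset _ _) hdis)
    (.inr fun a ha c hc h => by
      obtain ⟨h3, h4⟩ := Finset.mem_filter.1 hc
      exact (hpure c h3).resolve_left h4 a ha h.symm) (by omega)
  have := Finset.card_filter_add_card_filter_not (s := nb G (nN G X v) b) (fun x => ∀ s ∈ S, G.Adj x s)
  omega

lemma count_swap (G : SimpleGraph V) (X : Finset V) :
    ∑ v ∈ X, ∑ b ∈ nb G X v, (nN G (nN G X v) b).card
      = ∑ u ∈ X, ∑ v ∈ nN G X u, (nb G (nN G X u) v).card := by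
  have h1 : ∀ v, ∑ b ∈ nb G X v, (nN G (nN G X v) b).card
      = ∑ b ∈ X, ∑ u ∈ X, if (G.Adj v b ∧ ¬ G.Adj u v ∧ ¬ G.Adj u b) then 1 else 0 := by
    intro v
    unfold nb nN
    rw [Finset.sum_filter]
    refine Finset.sum_congr rfl fun b _ => ?_
    rw [Finset.filter_filter, Finset.card_filter]
    by_cases h : G.Adj v b
    · simp [h, G.adj_comm]
    · simp [h]
  have h2 : ∀ u, ∑ v ∈ nN G X u, (nb G (nN G X u) v).card
      = ∑ v ∈ X, ∑ b ∈ X, if (G.Adj v b ∧ ¬ G.Adj u v ∧ ¬ G.Adj u b) then 1 else 0 := by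
    intro u
    unfold nb nN
    rw [Finset.sum_filter]
    refine Finset.sum_congr rfl fun b _ => ?_
    rw [Finset.filter_filter, Finset.card_filter]
    by_cases h : G.Adj u b
    · simp [h]
    · simp [h, and_comm]
  simp_rw [h1, h2]
  calc _ = ∑ v ∈ X, ∑ u ∈ X, ∑ b ∈ X, (if (G.Adj v b ∧ ¬ G.Adj u v ∧ ¬ G.Adj u b) then 1 else 0) :=
        Finset.sum_congr rfl fun v _ => Finset.sum_comm
    _ = _ := Finset.sum_comm

lemma lemB {G : SimpleGraph V} (hP : P5E G) {X : Finset V} {m d : ℕ} (hno : NoPure G X m)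
    (hm : 1 ≤ m) (hd : 1 ≤ d) (hc : 1024 * d ^ 3 * m ≤ X.card) :
    ∃ Z ⊆ X, DenseIn G d Z ∧ m ≤ Z.card := by
  by_contra! hcon
  set n := X.card with hn
  have hd3 : 1 ≤ d ^ 3 := Nat.one_le_pow _ _ hd
  have hmn : 1024 * m ≤ n := by nlinarith
  -- Step 1
  have s1 : 2 * (X.filter fun v => 2 * d * (nN G X v).card ≤ n).card < n := by
    by_contra! hge
    have := hcon (X.filter fun v => 2 * d * (nN G X v).card ≤ n) (Finset.filter_subset _ _) (by
      intro z hz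
      have h1 := (Finset.mem_filter.1 hz).2
      have h2 := Finset.card_le_card (nN_mono G
        (Finset.filter_subset (fun v => 2 * d * (nN G X v).card ≤ n) X) z)
      have h3 := Nat.mul_le_mul_left d h2
      have h4 : 2 * d * (nN G X z).card = 2 * (d * (nN G X z).card) := by ring
      omega)
    omega
  set H := X.filter fun v => ¬ 2 * d * (nN G X v).card ≤ n with hH
  have s2 : n < 2 * H.card := by
    have : (X.filter fun v => 2 * d * (nN G X v).card ≤ n).card + H.card = n :=
      Finset.card_filter_add_card_filter_not _
    omega
  -- Step 2
  have s3 : ∀ v ∈ X, ((nb G X v).filter fun b => 3 * m ≤ (nN G (nN G X v) b).card).card ≤ 2 * m * d := by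
    intro v hv
    by_contra! hge
    have := hcon ((nb G X v).filter fun b => 3 * m ≤ (nN G (nN G X v) b).card)
      ((Finset.filter_subset _ _).trans (nb_sub _ _ _)) (by
      intro z hz
      obtain ⟨h1, h2⟩ := Finset.mem_filter.1 hz
      rw [mem_nb] at h1
      have h3 : nN G (nN G X v) z = nN G (nN G X z) v := by
        ext u; simp only [mem_nN]; tauto
      rw [h3] at h2
      have h4 := twins hP hno hm h1.2.symm h2
      have h5 : (nN G ((nb G X v).filter fun b => 3 * m ≤ (nN G (nN G X v) b).card) z).card
          ≤ (nb G (nN G X z) v).card := Finset.card_le_card fun u hu => by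
        rw [mem_nN, Finset.mem_filter, mem_nb] at hu
        rw [mem_nb, mem_nN]
        exact ⟨⟨hu.1.1.1, hu.2⟩, hu.1.1.2⟩
      have h6 := Nat.mul_le_mul_left d (h5.trans h4)
      have h7 : d * (2 * m) = 2 * m * d := by ring
      omega)
    nlinarith
  -- Step 3
  have s4 : ∀ v ∈ X, ∑ b ∈ nb G X v, (nN G (nN G X v) b).card ≤ 5 * d * m * n := by
    intro v hv
    have hle : ∀ b, (nN G (nN G X v) b).card ≤
        3 * m + if 3 * m ≤ (nN G (nN G X v) b).card then n else 0 := by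
      intro b
      have : (nN G (nN G X v) b).card ≤ n :=
        Finset.card_le_card ((nN_sub _ _ _).trans (nN_sub _ _ _))
      split_ifs <;> omega
    calc _ ≤ ∑ b ∈ nb G X v, (3 * m + if 3 * m ≤ (nN G (nN G X v) b).card then n else 0) :=
          Finset.sum_le_sum fun b _ => hle b
      _ = (nb G X v).card * (3 * m) +
            ((nb G X v).filter fun b => 3 * m ≤ (nN G (nN G X v) b).card).card * n := by
          rw [Finset.sum_add_distrib, Finset.sum_const, ← Finset.sum_filter, Finset.sum_const]
          simp
      _ ≤ n * (3 * m) + 2 * m * d * n := by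
          exact Nat.add_le_add (Nat.mul_le_mul_right _ (Finset.card_le_card (nb_sub _ _ _)))
            (Nat.mul_le_mul_right _ (s3 v hv))
      _ ≤ 5 * d * m * n := by
          have : m * n ≤ d * (m * n) := Nat.le_mul_of_pos_left _ hd
          nlinarith
  have s5 : ∑ u ∈ X, ∑ v ∈ nN G X u, (nb G (nN G X u) v).card ≤ n * (5 * d * m * n) := by
    rw [← count_swap]
    have := Finset.sum_le_card_nsmul X _ _ s4
    simpa using this
  obtain ⟨u, huH, hu⟩ : ∃ u ∈ H, ∑ v ∈ nN G X u, (nb G (nN G X u) v).card ≤ 10 * d * m * n := by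
    by_contra! hcon2
    have h1 : H.card * (10 * d * m * n) ≤ ∑ u ∈ H, ∑ v ∈ nN G X u, (nb G (nN G X u) v).card := by
      have := Finset.card_nsmul_le_sum H _ _ fun u hu => (hcon2 u hu).le
      simpa using this
    have h2 := Finset.sum_le_sum_of_subset (f := fun u => ∑ v ∈ nN G X u, (nb G (nN G X u) v).card)
      (Finset.filter_subset (fun v => ¬ 2 * d * (nN G X v).card ≤ n) X)
    have h3 := h1.trans (h2.trans s5)
    have hpos : 0 < 5 * d * m * n := by
      have : 0 < n := by omega
      have : 0 < d := hd
      have : 0 < m := hm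
      positivity
    nlinarith
  set A := nN G X u with hA
  have hAc : n < 2 * d * A.card := by
    exact not_le.1 (Finset.mem_filter.1 huH).2
  -- Step 4
  have s6 : (A.filter fun v => ¬ (nb G A v).card ≤ 40 * d ^ 2 * m).card * (40 * d ^ 2 * m)
      ≤ 10 * d * m * n := by
    refine le_trans ?_ hu
    have := Finset.card_nsmul_le_sum (A.filter fun v => ¬ (nb G A v).card ≤ 40 * d ^ 2 * m)
      (fun v => (nb G A v).card) (40 * d ^ 2 * m) fun v hv => by
        have := (Finset.mem_filter.1 hv).2
        omega
    rw [smul_eq_mul] at this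
    exact this.trans (Finset.sum_le_sum_of_subset (Finset.filter_subset _ _))
  have s7 : 4 * d * (A.filter fun v => ¬ (nb G A v).card ≤ 40 * d ^ 2 * m).card ≤ n := by
    have hpos : 0 < 10 * d * m := by
      have : 0 < n := by omega
      have : 0 < d := hd
      have : 0 < m := hm
      positivity
    refine Nat.le_of_mul_le_mul_left ?_ hpos
    linarith
  have s8 := Finset.card_filter_add_card_filter_not (s := A) (fun v => (nb G A v).card ≤ 40 * d ^ 2 * m)
  have s9 : n ≤ 4 * d * (A.filter fun v => (nb G A v).card ≤ 40 * d ^ 2 * m).card := by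
    rw [← s8] at hAc
    nlinarith
  refine sparse hP hno hm (A := A.filter fun v => (nb G A v).card ≤ 40 * d ^ 2 * m)
    ((Finset.filter_subset _ _).trans (nN_sub _ _ _)) (Δ := 40 * d ^ 2 * m) (fun v hv => ?_) ?_
  · exact (Finset.card_le_card (nb_mono G (Finset.filter_subset _ _) v)).trans (Finset.mem_filter.1 hv).2
  · have h1 : 4 * d * (256 * d ^ 2 * m) ≤ 4 * d * (A.filter fun v => (nb G A v).card ≤ 40 * d ^ 2 * m).card := by
      refine le_trans ?_ s9
      refine le_trans (le_of_eq ?_) hc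
      ring
    have h2 := Nat.le_of_mul_le_mul_left h1 (by omega)
    have h3 : 1 ≤ d ^ 2 := Nat.one_le_pow _ _ hd
    nlinarith

lemma wt_zero (G : SimpleGraph V) (Y : Finset V) : Wt G Y 0 :=
  ⟨∅, Finset.empty_subset _, fun a ha => absurd ha (Finset.notMem_empty a), by simp⟩

lemma Wt.le {G : SimpleGraph V} {Y : Finset V} {i j : ℕ} (h : Wt G Y j) (hs : i ≤ j) : Wt G Y i := by
  obtain ⟨F, h1, h2, h3⟩ := h
  exact ⟨F, h1, h2, hs.trans h3⟩

lemma lemD_aux {G : SimpleGraph V} (hP : P5E G) {X : Finset V} {q r d m : ℕ}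
    (hq : ∀ Y ⊆ X, q ≤ Y.card → Wt G Y r) (hd : 1 ≤ d) (hm : 1 ≤ m) (hqm : q ≤ m) (j : ℕ) :
    ∀ Y ⊆ X, m * (1024 * d ^ 3) ^ j ≤ Y.card →
      Wt G Y (2 ^ j * r) ∨ ∃ Z ⊆ Y, DenseIn G d Z ∧ m ≤ Z.card := by
  have hd3 : 1 ≤ d ^ 3 := Nat.one_le_pow _ _ hd
  induction j with
  | zero =>
    intro Y hY hc
    left
    simpa using hq Y hY (by simp at hc; omega)
  | succ j ih =>
    intro Y hY hc
    have hK : 1 ≤ (1024 * d ^ 3) ^ j := Nat.one_le_pow _ _ (by omega)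
    by_cases hno : NoPure G Y (m * (1024 * d ^ 3) ^ j)
    · right
      obtain ⟨Z, h1, h2, h3⟩ := lemB hP hno (by nlinarith) hd (by
        refine le_trans (le_of_eq ?_) hc
        ring)
      exact ⟨Z, h1, h2, by nlinarith⟩
    · unfold NoPure at hno
      push Not at hno
      obtain ⟨A, hA, B, hB, hdis, hpure, hAc, hBc⟩ := hno
      rcases ih A (hA.trans hY) hAc with h1 | ⟨Z, hZ, h⟩
      · rcases ih B (hB.trans hY) hBc with h2 | ⟨Z, hZ, h⟩
        · left
          have := (h1.add h2 hdis hpure).mono (Finset.union_subset hA hB)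
          rwa [← two_mul, ← mul_assoc, ← pow_succ'] at this
        · exact .inr ⟨Z, hZ.trans hB, h⟩
      · exact .inr ⟨Z, hZ.trans hA, h⟩

lemma lemD {G : SimpleGraph V} (hP : P5E G) {X : Finset V} {q r d m t κ : ℕ}
    (hq : ∀ Y ⊆ X, q ≤ Y.card → Wt G Y r) (hnt : ¬ Wt G X t) (ht : t ≤ 2 ^ κ * r)
    (hd : 1 ≤ d) (hm : 1 ≤ m) (hqm : q ≤ m) {Y : Finset V} (hY : Y ⊆ X)
    (hc : m * (1024 * d ^ 3) ^ κ ≤ Y.card) : ∃ Z ⊆ Y, DenseIn G d Z ∧ m ≤ Z.card :=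
  (lemD_aux hP hq hd hm hqm κ Y hY hc).resolve_left fun h => hnt ((h.mono hY).le ht)

lemma dense_conn {G : SimpleGraph V} {Z : Finset V} {d : ℕ} (hd : 3 ≤ d) (hZ : DenseIn G d Z) :
    Conn G Z := by
  intro P hP hne hPZ
  by_contra! hcon
  obtain ⟨y, hy⟩ := hne
  obtain ⟨z, hz, hz'⟩ : ∃ z ∈ Z, z ∉ P := by
    by_contra! h
    exact hPZ (Finset.Subset.antisymm hP h)
  have h1 : (Z \ P).card ≤ (nN G Z y).card := Finset.card_le_card fun u hu => by
    rw [Finset.mem_sdiff] at hu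
    exact mem_nN.2 ⟨hu.1, hcon y hy u hu.1 hu.2⟩
  have h2 : P.card ≤ (nN G Z z).card := Finset.card_le_card fun u hu =>
    mem_nN.2 ⟨hP hu, fun h => hcon u hu z hz hz' h.symm⟩
  have h3 := hZ y (hP hy)
  have h4 := hZ z hz
  have h5 := Nat.mul_le_mul hd h1
  have h6 := Nat.mul_le_mul hd h2
  have h7 := Finset.card_pos.2 ⟨z, hz⟩
  rw [Finset.card_sdiff_of_subset hP] at h5
  have := Finset.card_le_card hP
  omega

lemma inner_step {G : SimpleGraph V} (hP : P5E G) {X : Finset V} {q r t κ k : ℕ}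
    (hq : ∀ Y ⊆ X, q ≤ Y.card → Wt G Y r) (hnt : ¬ Wt G X t) (ht : t ≤ 2 ^ κ * r)
    (hk : 1 ≤ k) (ht1 : 1 ≤ t) (hq1 : 1 ≤ q) {v : V} {A1 W0 : Finset V} (hA1X : A1 ⊆ X)
    (hA1 : DenseIn G (16 * k ^ 2) A1) (hv : ∀ a ∈ A1, ¬ G.Adj v a)
    (hW0 : ∀ b ∈ W0, G.Adj v b ∧ 4 * k * (nN G A1 b).card ≤ A1.card)
    (hc : 4 * t * (q * (1024 * (16 * k ^ 2) ^ 3) ^ κ) ≤ A1.card) (j : ℕ) :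
    ∀ U ⊆ A1, A1.card * (k + j) ≤ 2 * k * U.card →
      Wt G U (j * r) ∨ ∃ A ⊆ U, A1.card ≤ 2 * A.card ∧ ∀ b ∈ W0, 2 * t * (nN G A b).card ≤ A.card := by
  have hk2 : 1 ≤ k ^ 2 := Nat.one_le_pow _ _ hk
  induction j with
  | zero =>
    intro U _ _
    left
    simpa using wt_zero G U
  | succ j ih =>
    intro U hU hUc
    have hhalf : A1.card ≤ 2 * U.card := by
      have : k * A1.card ≤ k * (2 * U.card) := by nlinarith
      exact Nat.le_of_mul_le_mul_left this hk
    by_cases hall : ∀ b ∈ W0, 2 * t * (nN G U b).card ≤ U.card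
    · exact .inr ⟨U, subset_rfl, hhalf, hall⟩
    push Not at hall
    obtain ⟨b, hb, hbU⟩ := hall
    obtain ⟨hvb, hbA⟩ := hW0 b hb
    have hbig : q * (1024 * (16 * k ^ 2) ^ 3) ^ κ ≤ (nN G U b).card := by
      have : 4 * t * (q * (1024 * (16 * k ^ 2) ^ 3) ^ κ) ≤ 4 * t * (nN G U b).card := by nlinarith
      exact Nat.le_of_mul_le_mul_left this (by omega)
    obtain ⟨Z, hZ, hZd, hZc⟩ := lemD hP hq hnt ht (by omega) hq1 le_rfl
      ((nN_sub G U b).trans (hU.trans hA1X)) hbig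
    have hZU := hZ.trans (nN_sub G U b)
    obtain ⟨s, hs⟩ : Z.Nonempty := Finset.card_pos.1 (by omega)
    have hconn := dense_conn (by omega) hZd
    have e1 := nb_add_nN G U b
    have e2 := nb_add_nN G (nb G U b) s
    have e3 : (nN G (nb G U b) s).card ≤ (nN G A1 s).card :=
      Finset.card_le_card (nN_mono G ((nb_sub _ _ _).trans hU) s)
    have e4 : (nN G U b).card ≤ (nN G A1 b).card := Finset.card_le_card (nN_mono G hU b)
    have e5 := hA1 s (hU (hZU hs))
    have e6 : 4 * k * (nN G A1 s).card ≤ A1.card := by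
      refine le_trans ?_ e5
      exact Nat.mul_le_mul_right _ (by nlinarith)
    have hU' : nb G (nb G U b) s ⊆ U := (nb_sub _ _ _).trans (nb_sub _ _ _)
    have hU'c : A1.card * (k + j) ≤ 2 * k * (nb G (nb G U b) s).card := by
      have f1 : U.card ≤ (nb G (nb G U b) s).card + (nN G A1 s).card + (nN G A1 b).card := by omega
      have f2 := Nat.mul_le_mul_left (2 * k) f1
      nlinarith
    rcases ih _ (hU'.trans hU) hU'c with h | ⟨A, hA, h⟩
    · left
      have hcomp : Comp G (nb G (nb G U b) s) Z := by
        intro x hx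
        rw [mem_nb, mem_nb] at hx
        exact (pure_of_conn hP hconn hvb (fun z hz => hv z (hU (hZU hz)))
          (fun z hz => (mem_nN.1 (hZ hz)).2) hx.1.2 (hv x (hU hx.1.1))).resolve_right
          fun h => h s hs hx.2.symm
      have := (h.add (hq Z (hZU.trans (hU.trans hA1X)) hZc) (comp_disj hcomp) (.inl hcomp)).mono
        (Finset.union_subset hU' hZU)
      rwa [add_mul, one_mul]
    · exact .inr ⟨A, hA.trans hU', h⟩

lemma count2 (G : SimpleGraph V) (A B : Finset V) :
    ∑ b ∈ B, (nN G A b).card = ∑ a ∈ A, (nN G B a).card := by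
  unfold nN
  simp_rw [Finset.card_filter]
  rw [Finset.sum_comm]
  simp_rw [G.adj_comm]

set_option maxHeartbeats 1000000 in
lemma outer_step {G : SimpleGraph V} (hP : P5E G) {X : Finset V} {q r t κ : ℕ}
    (hq : ∀ Y ⊆ X, q ≤ Y.card → Wt G Y r) (hnt : ¬ Wt G X t) (ht : t ≤ 2 ^ κ * r)
    (k : ℕ) (hkk : k = 2 ^ κ) (ht1 : 1 ≤ t) (hq1 : 1 ≤ q) {X0 : Finset V} (hX0 : X0 ⊆ X)
    (hX0d : DenseIn G (16 * k ^ 2) X0) (K : ℕ) (hK : K = (1024 * (16 * k ^ 2) ^ 3) ^ κ)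
    (hc : 64 * k * t ^ 2 * q * K ^ 2 ≤ X0.card) (j : ℕ) :
    ∀ W ⊆ X0, X0.card * (k + j) ≤ 2 * k * W.card → Wt G W (j * r) := by
  have hk : 1 ≤ k := by rw [hkk]; exact Nat.one_le_two_pow
  have hk2 : 1 ≤ k ^ 2 := Nat.one_le_pow _ _ hk
  have hK1 : 1 ≤ K := by
    rw [hK]
    exact Nat.one_le_pow _ _ (by positivity)
  induction j with
  | zero =>
    intro W _ _
    simpa using wt_zero G W
  | succ j ih =>
    intro W hW hWc
    have key : ∃ A ⊆ W, ∃ W' ⊆ W, 2 * q ≤ A.card ∧ X0.card * (k + j) ≤ 2 * k * W'.card ∧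
        ∀ b ∈ W', 2 * t * (nN G A b).card ≤ A.card := by
      set c := X0.card / (2 * k) with hcdef
      have hc1 : 2 * k * c ≤ X0.card := Nat.mul_div_le _ _
      have hc2 : 32 * t ^ 2 * q * K ^ 2 ≤ c := by
        rw [hcdef, Nat.le_div_iff_mul_le (by omega)]
        refine le_trans (le_of_eq ?_) hc
        ring
      have htq : q ≤ t ^ 2 * q * K ^ 2 := by
        have h1 : 0 < t ^ 2 := by positivity
        have h2 : 0 < K ^ 2 := by positivity
        calc q ≤ t ^ 2 * q := Nat.le_mul_of_pos_left _ h1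
          _ ≤ _ := Nat.le_mul_of_pos_right _ h2
      by_cases hall : ∀ b ∈ W, 2 * t * (nN G W b).card ≤ c
      · have hcW : c ≤ W.card := by
          have : 2 * k * c ≤ 2 * k * W.card := by nlinarith
          exact Nat.le_of_mul_le_mul_left this (by omega)
        obtain ⟨B, hB, hBc⟩ := Finset.exists_subset_card_eq hcW
        refine ⟨B, hB, W \ B, Finset.sdiff_subset, by nlinarith, ?_, fun b hb => ?_⟩
        · rw [Finset.card_sdiff_of_subset hB, hBc, Nat.mul_sub]
          apply Nat.le_sub_of_add_le
          nlinarith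
        · rw [hBc]
          refine le_trans ?_ (hall b (Finset.sdiff_subset hb))
          gcongr
          exact nN_mono G hB b
      · push Not at hall
        obtain ⟨v, hv, hvc⟩ := hall
        have hA0 : ((nN G W v).erase v).card + 1 = (nN G W v).card :=
          Finset.card_erase_add_one (mem_nN.2 ⟨hv, G.loopless.irrefl v⟩)
        have hA0W : (nN G W v).erase v ⊆ W := (Finset.erase_subset _ _).trans (nN_sub _ _ _)
        have h16 : 16 * t * q * K ^ 2 < (nN G W v).card := by
          have : 2 * t * (16 * t * q * K ^ 2) < 2 * t * (nN G W v).card := by nlinarith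
          exact Nat.lt_of_mul_lt_mul_left this
        obtain ⟨A1, hA1, hA1d, hA1c⟩ := lemD (m := 4 * t * (q * K)) (d := 16 * k ^ 2) hP hq hnt ht
          (by omega) (by have : 0 < t := ht1
                         have : 0 < q := hq1
                         have : 0 < K := hK1
                         exact Nat.succ_le_of_lt (by positivity))
          (by calc q ≤ q * K := Nat.le_mul_of_pos_right _ hK1
                _ ≤ _ := Nat.le_mul_of_pos_left _ (by omega)) (hA0W.trans (hW.trans hX0)) (by
            rw [← hK]
            have : 4 * t * (q * K) * K = 4 * (t * q * K ^ 2) := by ring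
            have h2 : 16 * t * q * K ^ 2 = 16 * (t * q * K ^ 2) := by ring
            omega)
        have hA1W := hA1.trans hA0W
        have hvA1 : ∀ a ∈ A1, ¬ G.Adj v a := fun a ha =>
          (mem_nN.1 (Finset.mem_of_mem_erase (hA1 ha))).2
        set W0 := (nb G W v).filter fun b => 4 * k * (nN G A1 b).card ≤ A1.card with hW0
        set bad := (nb G W v).filter fun b => ¬ 4 * k * (nN G A1 b).card ≤ A1.card with hbad
        have hq4 : 4 * q ≤ A1.card := by
          refine le_trans ?_ hA1c
          have h1 : q ≤ q * K := Nat.le_mul_of_pos_right _ hK1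
          nlinarith
        have hW0W : W0 ⊆ W := (Finset.filter_subset _ _).trans (nb_sub _ _ _)
        have hbadW : bad ⊆ X0 := ((Finset.filter_subset _ _).trans (nb_sub _ _ _)).trans hW
        have g1 : bad.card * A1.card ≤ 4 * k * ∑ b ∈ X0, (nN G A1 b).card := by
          rw [Finset.mul_sum]
          have := Finset.card_nsmul_le_sum bad (fun b => 4 * k * (nN G A1 b).card) A1.card
            fun b hb => by
              have := (Finset.mem_filter.1 hb).2
              omega
          rw [smul_eq_mul] at this
          exact this.trans (Finset.sum_le_sum_of_subset hbadW)
        have g2 : 16 * k ^ 2 * ∑ b ∈ X0, (nN G A1 b).card ≤ A1.card * X0.card := by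
          rw [count2, Finset.mul_sum]
          have := Finset.sum_le_card_nsmul A1 (fun a => 16 * k ^ 2 * (nN G X0 a).card) X0.card
            fun a ha => hX0d a (hW (hA1W ha))
          simpa using this
        have g3 : 4 * k * bad.card ≤ X0.card := by
          have : A1.card * (4 * k * bad.card) ≤ A1.card * X0.card := by nlinarith
          exact Nat.le_of_mul_le_mul_left this (by omega)
        have g4 : 4 * k * (nN G W v).card ≤ X0.card := by
          refine le_trans ?_ (hX0d v (hW hv))
          have h1 : 4 * k ≤ 16 * k ^ 2 := by nlinarith
          exact Nat.mul_le_mul h1 (Finset.card_le_card (nN_mono G hW v))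
        have g5 := nb_add_nN G W v
        have g6 : W0.card + bad.card = (nb G W v).card := Finset.card_filter_add_card_filter_not _
        have g7 : X0.card * (k + j) ≤ 2 * k * W0.card := by
          have f1 : W.card = W0.card + bad.card + (nN G W v).card := by omega
          rw [f1] at hWc
          linarith
        rcases inner_step hP hq hnt ht hk ht1 hq1 (hA1W.trans (hW.trans hX0)) hA1d hvA1 (W0 := W0)
          (fun b hb => by
            obtain ⟨h1, h2⟩ := Finset.mem_filter.1 hb
            exact ⟨(mem_nb.1 h1).2, h2⟩) (by rw [← hK]; exact hA1c) k A1 subset_rfl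
            (le_of_eq (by ring)) with h | ⟨A, hA, hAc, hAb⟩
        · exact absurd ((h.mono (hA1W.trans (hW.trans hX0))).le (by rw [hkk]; exact ht)) hnt
        · exact ⟨A, hA.trans hA1W, W0, hW0W, by omega, g7, hAb⟩
    obtain ⟨A, hA, W', hW', hAq, hW'c, hAb⟩ := key
    obtain ⟨F, hF, hF4, hFc⟩ := ih W' (hW'.trans hW) hW'c
    have hFt : F.card < t := by
      by_contra! h
      exact hnt ⟨F, hF.trans (hW'.trans (hW.trans hX0)), hF4, h⟩
    set A' := A.filter fun a => ∀ b ∈ F, G.Adj b a with hA'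
    have h1 : (A.filter fun a => ¬ ∀ b ∈ F, G.Adj b a).card ≤ ∑ b ∈ F, (nN G A b).card := by
      refine le_trans (Finset.card_le_card ?_) Finset.card_biUnion_le
      intro a ha
      rw [Finset.mem_filter] at ha
      obtain ⟨ha, h⟩ := ha
      push Not at h
      obtain ⟨b, hb, hba⟩ := h
      exact Finset.mem_biUnion.2 ⟨b, hb, mem_nN.2 ⟨ha, hba⟩⟩
    have h2 : 2 * t * ∑ b ∈ F, (nN G A b).card ≤ F.card * A.card := by
      rw [Finset.mul_sum]
      have := Finset.sum_le_card_nsmul F (fun b => 2 * t * (nN G A b).card) A.card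
        fun b hb => hAb b (hF hb)
      simpa using this
    have h3 : 2 * (A.filter fun a => ¬ ∀ b ∈ F, G.Adj b a).card ≤ A.card := by
      have : t * (2 * (A.filter fun a => ¬ ∀ b ∈ F, G.Adj b a).card) ≤ t * A.card := by nlinarith
      exact Nat.le_of_mul_le_mul_left this ht1
    have h4 : A'.card + (A.filter fun a => ¬ ∀ b ∈ F, G.Adj b a).card = A.card :=
      Finset.card_filter_add_card_filter_not _
    have hA'A : A' ⊆ A := Finset.filter_subset _ _
    have hcomp : Comp G F A' := fun b hb a ha => (Finset.mem_filter.1 ha).2 b hb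
    have h5 : Wt G F (j * r) := ⟨F, subset_rfl, hF4, hFc⟩
    have := (h5.add (hq A' (hA'A.trans (hA.trans (hW.trans hX0))) (by omega)) (comp_disj hcomp)
      (.inl hcomp)).mono (Finset.union_subset (hF.trans hW') (hA'A.trans hA))
    rwa [add_mul, one_mul]

lemma main_comb {G : SimpleGraph V} (hP : P5E G) {X : Finset V} {q r t κ : ℕ}
    (hq : ∀ Y ⊆ X, q ≤ Y.card → Wt G Y r) (ht : t ≤ 2 ^ κ * r) (ht1 : 1 ≤ t) (hq1 : 1 ≤ q)
    (hc : 64 * 2 ^ κ * t ^ 2 * q * ((2 ^ (22 + 6 * κ)) ^ κ) ^ 3 ≤ X.card) : Wt G X t := by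
  by_contra hnt
  have hK : (2 ^ (22 + 6 * κ)) ^ κ = (1024 * (16 * (2 ^ κ) ^ 2) ^ 3) ^ κ := by
    congr 1
    rw [pow_add, mul_comm 6 κ, pow_mul]
    generalize 2 ^ κ = k
    ring
  have hK1 : 1 ≤ (2 ^ (22 + 6 * κ)) ^ κ := Nat.one_le_pow _ _ (by positivity)
  obtain ⟨X0, hX0, hX0d, hX0c⟩ := lemD (m := 64 * 2 ^ κ * t ^ 2 * q * ((2 ^ (22 + 6 * κ)) ^ κ) ^ 2)
    (d := 16 * (2 ^ κ) ^ 2) hP hq hnt ht (Nat.succ_le_of_lt (by positivity))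
    (Nat.succ_le_of_lt (by positivity))
    (by
      calc q ≤ 64 * 2 ^ κ * t ^ 2 * q := Nat.le_mul_of_pos_left _ (by positivity)
        _ ≤ _ := Nat.le_mul_of_pos_right _ (by positivity)) subset_rfl (by
      rw [← hK]
      refine le_trans (le_of_eq ?_) hc
      ring)
  have := outer_step hP hq hnt ht (2 ^ κ) rfl ht1 hq1 hX0 hX0d _ hK hX0c (2 ^ κ) X0 subset_rfl
    (le_of_eq (by ring))
  exact hnt ((this.mono hX0).le ht)

lemma thresh (G : SimpleGraph V) (m : ℕ) : ∀ X : Finset V, 2 ^ m ≤ X.card → Wt G X (m + 1) := by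
  have hsing : ∀ v : V, Wt G {v} 1 := fun v => ⟨{v}, subset_rfl, by
    intro a ha b hb c hc d hd hab
    simp only [Finset.mem_singleton] at ha hb
    subst ha hb
    exact absurd hab (G.loopless.irrefl _), by simp⟩
  induction m with
  | zero =>
    intro X hX
    obtain ⟨v, hv⟩ : X.Nonempty := Finset.card_pos.1 (by simpa using hX)
    exact (hsing v).mono (by simpa using hv)
  | succ m ih =>
    intro X hX
    have hpos : 0 < 2 ^ m := by positivity
    rw [pow_succ] at hX
    obtain ⟨v, hv⟩ : X.Nonempty := Finset.card_pos.1 (by omega)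
    have e1 := nb_add_nN G X v
    have e2 : ((nN G X v).erase v).card + 1 = (nN G X v).card :=
      Finset.card_erase_add_one (mem_nN.2 ⟨hv, G.loopless.irrefl v⟩)
    by_cases h : 2 ^ m ≤ (nb G X v).card
    · have hc : Comp G (nb G X v) {v} := by
        intro a ha b hb
        rw [Finset.mem_singleton] at hb
        subst hb
        exact (mem_nb.1 ha).2.symm
      exact ((ih _ h).add (hsing v) (comp_disj hc) (.inl hc)).mono
        (Finset.union_subset (nb_sub _ _ _) (by simpa using hv))
    · have hc : Anti G ((nN G X v).erase v) {v} := by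
        intro a ha b hb
        rw [Finset.mem_singleton] at hb
        subst hb
        exact fun hh => (mem_nN.1 (Finset.mem_of_mem_erase ha)).2 hh.symm
      exact ((ih _ (by omega)).add (hsing v) (by simp) (.inr hc)).mono
        (Finset.union_subset ((Finset.erase_subset _ _).trans (nN_sub _ _ _)) (by simpa using hv))

noncomputable def tgt (n : ℕ) : ℕ := ⌈(2 : ℝ) ^ ((Real.logb 2 n) ^ ((2 : ℝ) / 3) / 16)⌉₊

lemma small_bound {n : ℕ} (hn : 1 ≤ n) {m : ℕ} (h : (m : ℝ) ≤ Real.logb 2 n) : 2 ^ m ≤ n := by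
  have h0 : (0 : ℝ) < n := by exact_mod_cast hn
  have := (Real.le_logb_iff_rpow_le (by norm_num : (1 : ℝ) < 2) h0).1 h
  rw [Real.rpow_natCast] at this
  exact_mod_cast this

lemma tgt_le {n : ℕ} {e m : ℕ} (h : (Real.logb 2 n) ^ ((2 : ℝ) / 3) / 16 ≤ e) (hm : 2 ^ e ≤ m) :
    tgt n ≤ m := by
  unfold tgt
  refine le_trans (Nat.ceil_le.2 ?_) hm
  calc (2 : ℝ) ^ ((Real.logb 2 n) ^ ((2 : ℝ) / 3) / 16) ≤ (2 : ℝ) ^ (e : ℝ) :=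
        Real.rpow_le_rpow_of_exponent_le (by norm_num) h
    _ = _ := by rw [Real.rpow_natCast]; push_cast; rfl

lemma arith {n : ℕ} (hn : 1 ≤ n) {y : ℝ} (hy : 12 < y) (hy3 : Real.logb 2 n = y ^ 3) :
    ∃ q κ : ℕ, 1 ≤ q ∧ q < n ∧ tgt n ≤ 2 ^ κ * tgt q ∧
      64 * 2 ^ κ * (tgt n) ^ 2 * q * ((2 ^ (22 + 6 * κ)) ^ κ) ^ 3 ≤ n := by
  have hn0 : (0 : ℝ) < n := by exact_mod_cast hn
  set κ := ⌊y / 3⌋₊ with hκ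
  have k1 : (κ : ℝ) ≤ y / 3 := Nat.floor_le (by linarith)
  have k2 : y / 3 < κ + 1 := Nat.lt_floor_add_one _
  have hy23 : (y ^ 3) ^ ((2 : ℝ) / 3) = y ^ 2 := by
    rw [← Real.rpow_natCast y 3, ← Real.rpow_mul (by linarith), ← Real.rpow_natCast y 2]
    norm_num
  set t := tgt n with ht
  have ht' : t = ⌈(2 : ℝ) ^ (y ^ 2 / 16)⌉₊ := by rw [ht, tgt, hy3, hy23]
  have t1 : (t : ℝ) ≤ 2 ^ (y ^ 2 / 16 + 1) := by
    have h1 : (1 : ℝ) ≤ 2 ^ (y ^ 2 / 16) := Real.one_le_rpow (by norm_num) (by positivity)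
    have h2 := Nat.ceil_lt_add_one (a := (2 : ℝ) ^ (y ^ 2 / 16)) (by positivity)
    rw [ht', Real.rpow_add (by norm_num), Real.rpow_one]
    linarith
  have t0 : 1 ≤ t := by
    rw [ht']
    exact Nat.one_le_ceil_iff.2 (by positivity)
  set c : ℝ := 9 + y ^ 2 / 8 + 67 * κ + 18 * κ ^ 2 with hc
  have hcle : c ≤ 16 * κ * y := by
    have k3 : y / 4 ≤ κ := by linarith
    have k0 : (0 : ℝ) ≤ κ := by positivity
    have a1 : 18 * (κ : ℝ) ^ 2 ≤ 6 * (κ * y) := by nlinarith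
    have a2 : 12 * (κ : ℝ) ≤ κ * y := by nlinarith
    have a3 : y ^ 2 / 4 ≤ κ * y := by nlinarith
    have a4 : 36 ≤ y ^ 2 / 4 := by nlinarith
    rw [hc]
    nlinarith
  have hcL : c ≤ y ^ 3 := by
    have : 16 * κ * y ≤ y ^ 3 := by
      have : 16 * (κ : ℝ) ≤ y ^ 2 := by nlinarith
      nlinarith
    linarith
  set M := 64 * 2 ^ κ * t ^ 2 * ((2 ^ (22 + 6 * κ)) ^ κ) ^ 3 with hM
  have M64 : 64 ≤ M := by
    have : 0 < 2 ^ κ * t ^ 2 * ((2 ^ (22 + 6 * κ)) ^ κ) ^ 3 := by positivity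
    have e : M = 64 * (2 ^ κ * t ^ 2 * ((2 ^ (22 + 6 * κ)) ^ κ) ^ 3) := by rw [hM]; ring
    omega
  have hMr : (M : ℝ) ≤ 2 ^ (c - 1) := by
    have e1 : (M : ℝ) = (2 : ℝ) ^ (6 + κ + 66 * κ + 18 * κ ^ 2 : ℕ) * (t : ℝ) ^ 2 := by
      rw [hM]
      push_cast
      have : (64 : ℝ) = 2 ^ 6 := by norm_num
      rw [this, ← pow_mul, ← pow_mul]
      have e2 : (22 + 6 * κ) * (κ * 3) = 66 * κ + 18 * κ ^ 2 := by ring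
      rw [e2, add_assoc (6 + κ), pow_add _ (6 + κ), pow_add _ 6]
      ring
    have e3 : (2 : ℝ) ^ (c - 1) = (2 : ℝ) ^ (6 + κ + 66 * κ + 18 * κ ^ 2 : ℕ)
        * ((2 : ℝ) ^ (y ^ 2 / 16 + 1)) ^ 2 := by
      rw [← Real.rpow_natCast 2, ← Real.rpow_natCast ((2 : ℝ) ^ (y ^ 2 / 16 + 1)),
        ← Real.rpow_mul (by norm_num), ← Real.rpow_add (by norm_num)]
      congr 1
      rw [hc]
      push_cast
      ring
    rw [e1, e3]
    gcongr
  have hn2 : (n : ℝ) = 2 ^ (y ^ 3) := by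
    rw [← hy3, Real.rpow_logb (by norm_num) (by norm_num) hn0]
  have hMn : M ≤ n := by
    have : (M : ℝ) ≤ n := by
      rw [hn2]
      exact hMr.trans (Real.rpow_le_rpow_of_exponent_le (by norm_num) (by linarith))
    exact_mod_cast this
  set q := n / M with hq
  have q1 : 1 ≤ q := (Nat.one_le_div_iff (by omega)).2 hMn
  have qM : M * q ≤ n := Nat.mul_div_le _ _
  have qn : n < M * (q + 1) := Nat.lt_mul_div_succ _ (by omega)
  have hqlog : y ^ 3 - c ≤ Real.logb 2 q := by
    rw [Real.le_logb_iff_rpow_le (by norm_num) (by exact_mod_cast q1)]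
    have h1 : (n : ℝ) ≤ M * (2 * q) := by
      have : n ≤ M * (2 * q) := by nlinarith
      exact_mod_cast this
    have h2 : (2 : ℝ) ^ (y ^ 3) ≤ 2 ^ (c - 1) * (2 * q) := by
      rw [← hn2]
      refine h1.trans ?_
      gcongr
    have h3 : (2 : ℝ) ^ (y ^ 3) = 2 ^ (y ^ 3 - c) * (2 ^ (c - 1) * 2) := by
      rw [← Real.rpow_add_one (by norm_num), ← Real.rpow_add (by norm_num)]
      congr 1
      ring
    have h4 : (0 : ℝ) < 2 ^ (c - 1) * 2 := by positivity
    rw [h3] at h2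
    refine le_of_mul_le_mul_right ?_ h4
    linarith
  refine ⟨q, κ, q1, by nlinarith, ?_, ?_⟩
  · rw [ht', Nat.ceil_le]
    have h1 : (2 : ℝ) ^ ((Real.logb 2 q) ^ ((2 : ℝ) / 3) / 16) ≤ tgt q := Nat.le_ceil _
    push_cast
    refine le_trans ?_ (mul_le_mul_of_nonneg_left h1 (by positivity))
    rw [← Real.rpow_natCast (2 : ℝ) κ, ← Real.rpow_add (by norm_num)]
    apply Real.rpow_le_rpow_of_exponent_le (by norm_num)
    have c0 : 0 ≤ c := by positivity
    have y3 : 0 < y ^ 3 := by positivity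
    have h2 : (y ^ 3 - c) ^ ((2 : ℝ) / 3) ≤ (Real.logb 2 q) ^ ((2 : ℝ) / 3) :=
      Real.rpow_le_rpow (by linarith) hqlog (by norm_num)
    have h3 : y ^ 3 - c = y ^ 3 * (1 - c / y ^ 3) := by field_simp
    have x1 : c / y ^ 3 ≤ 1 := (div_le_one y3).2 hcL
    have x0 : 0 ≤ c / y ^ 3 := by positivity
    rw [h3, Real.mul_rpow y3.le (by linarith), hy23] at h2
    have h4 : 1 - c / y ^ 3 ≤ (1 - c / y ^ 3) ^ ((2 : ℝ) / 3) :=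
      Real.self_le_rpow_of_le_one (by linarith) (by linarith) (by norm_num)
    have h5 : y ^ 2 * (1 - c / y ^ 3) = y ^ 2 - c / y := by field_simp
    have h6 : c / y ≤ 16 * κ := (div_le_iff₀ (by linarith)).2 hcle
    have h7 := mul_le_mul_of_nonneg_left h4 (sq_nonneg y)
    linarith
  · refine le_trans (le_of_eq ?_) qM
    rw [hM]
    ring

lemma final_wt {G : SimpleGraph V} (hP : P5E G) (n : ℕ) :
    ∀ X : Finset V, X.card = n → 1 ≤ n → Wt G X (tgt n) := by
  induction n using Nat.strong_induction_on with
  | _ n ih =>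
  intro X hX hn
  have hL : 0 ≤ Real.logb 2 n := Real.logb_nonneg (by norm_num) (by exact_mod_cast hn)
  obtain ⟨y, hy0, hy3⟩ : ∃ y : ℝ, 0 ≤ y ∧ Real.logb 2 n = y ^ 3 :=
    ⟨(Real.logb 2 n) ^ ((1 : ℝ) / 3), by positivity, by
      rw [← Real.rpow_natCast, ← Real.rpow_mul hL]; norm_num⟩
  have hy23 : (Real.logb 2 n) ^ ((2 : ℝ) / 3) = y ^ 2 := by
    rw [hy3, ← Real.rpow_natCast y 3, ← Real.rpow_mul hy0, ← Real.rpow_natCast y 2]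
    norm_num
  have small : ∀ m e : ℕ, (m : ℝ) ≤ Real.logb 2 n → y ^ 2 / 16 ≤ e → 2 ^ e ≤ m + 1 →
      Wt G X (tgt n) := fun m e h1 h2 h3 =>
    (thresh G m X (hX ▸ small_bound hn h1)).le (tgt_le (by rw [hy23]; exact h2) h3)
  rcases le_or_gt y 12 with h12 | h12
  · rcases le_or_gt y 4 with h4 | h4
    · rcases eq_or_lt_of_le hn with h1 | h1
      · have : y = 0 := by
          rw [← h1] at hy3
          simp at hy3
          exact (pow_eq_zero_iff (by norm_num)).1 hy3.symm
        exact small 0 0 (by simpa using hL) (by rw [this]; norm_num) (by norm_num)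
      · refine small 1 1 ?_ (by push_cast; nlinarith) (by norm_num)
        rw [Real.le_logb_iff_rpow_le (by norm_num) (by exact_mod_cast hn)]
        push_cast
        rw [Real.rpow_one]
        exact_mod_cast h1
    · rcases le_or_gt y 8 with h8 | h8
      · refine small 64 4 ?_ (by push_cast; nlinarith) (by norm_num)
        rw [hy3]
        have := pow_le_pow_left₀ (by norm_num) h4.le 3
        norm_num at this ⊢
        exact this
      · refine small 512 9 ?_ (by push_cast; nlinarith) (by norm_num)
        rw [hy3]
        have := pow_le_pow_left₀ (by norm_num) h8.le 3
        norm_num at this ⊢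
        exact this
  · obtain ⟨q, κ, q1, qn, h1, h2⟩ := arith hn h12 hy3
    refine main_comb hP (q := q) (r := tgt q) (κ := κ) (fun Y _ hYc => ?_) h1 ?_ q1 (by rw [hX]; exact h2)
    · obtain ⟨Y', hY', hc⟩ := Finset.exists_subset_card_eq hYc
      exact (ih q qn Y' hc q1).mono hY'
    · exact Nat.one_le_ceil_iff.2 (by positivity)

end aux

theorem stmt_3 {V : Type} [Fintype V] (G : SimpleGraph V)
    (hn : 1 ≤ Fintype.card V) (hP5 : P5Free G) :
    ∃ s : Finset V, IsCographSet G s ∧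
      (2 : ℝ) ^ ((Real.logb 2 (Fintype.card V)) ^ ((2 : ℝ) / 3) / 16) ≤ (s.card : ℝ) := by
  obtain ⟨F, -, hF, hc⟩ := final_wt (p5e_of_free G hP5) _ Finset.univ Finset.card_univ hn
  exact ⟨F, cog_of_p4e G F hF, (Nat.le_ceil _).trans (by exact_mod_cast hc)⟩
end

section
/- For every positive integer m, any F4-free graph G on m^3 vertices contains a homogeneous set of size at least m, i.e., a clique or an independent set of size at least m. -/
open SimpleGraph

/-- `F4`: the four-vertex graph consisting of the path `0 - 1 - 2` together with the
isolated vertex `3`. -/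
def F4 : SimpleGraph (Fin 4) :=
  SimpleGraph.fromRel (fun a b => (a = 0 ∧ b = 1) ∨ (a = 1 ∧ b = 2))

open Classical in
theorem cover_aux {V : Type} (H : SimpleGraph V) (S : Finset V) (b c : ℕ)
    (hb : ∀ K : Finset V, K ⊆ S → H.IsClique (K : Set V) → K.card ≤ b)
    (hc : ∀ i ∈ S, (S.filter (fun x => ¬ H.Adj i x)).card ≤ c) : S.card ≤ b * c := by
  obtain ⟨K, hK, hmax⟩ := Finset.exists_max_image
    (S.powerset.filter (fun K : Finset V => H.IsClique (K : Set V))) Finset.card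
    ⟨∅, by simp⟩
  simp only [Finset.mem_filter, Finset.mem_powerset] at hK hmax
  have hsub : S ⊆ K.biUnion (fun i => S.filter (fun x => ¬ H.Adj i x)) := by
    intro x hx
    by_contra hcon
    simp only [Finset.mem_biUnion, Finset.mem_filter, not_exists, not_and, not_not] at hcon
    have hadj : ∀ i ∈ K, H.Adj i x := fun i hi => hcon i hi hx
    have hxK : x ∉ K := fun h => H.loopless.irrefl x (hadj x h)
    have h1 := hmax (insert x K) ⟨Finset.insert_subset hx hK.1, by
      rw [Finset.coe_insert, SimpleGraph.isClique_insert]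
      exact ⟨hK.2, fun i hi _ => (hadj i hi).symm⟩⟩
    rw [Finset.card_insert_of_notMem hxK] at h1
    omega
  calc S.card ≤ _ := Finset.card_le_card hsub
    _ ≤ K.card * c := Finset.card_biUnion_le_card_mul _ _ _ (fun i hi => hc i (hK.1 hi))
    _ ≤ b * c := Nat.mul_le_mul_right _ (hb K hK.1 hK.2)

theorem f4_aux {V : Type} (G : SimpleGraph V) (hfree : IndFree F4 G) (v i x y : V)
    (hvi : ¬ G.Adj v i) (hvx : ¬ G.Adj v x) (hvy : ¬ G.Adj v y)
    (hix : G.Adj i x) (hiy : G.Adj i y) (hxy : x ≠ y) : G.Adj x y := by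
  by_contra hn
  have h1 : i ≠ v := by rintro rfl; exact hvx hix
  have h2 : x ≠ v := by rintro rfl; exact hvi hix.symm
  have h3 : y ≠ v := by rintro rfl; exact hvi hiy.symm
  have h4 := hix.ne
  have h5 := hiy.ne
  apply hfree
  refine ⟨⟨⟨![x, i, y, v], ?_⟩, ?_⟩⟩
  · intro a b h
    fin_cases a <;> fin_cases b <;> simp_all
  · intro a b
    change G.Adj (![x, i, y, v] a) (![x, i, y, v] b) ↔ F4.Adj a b
    have hvi' := fun h : G.Adj i v => hvi h.symm
    have hvx' := fun h : G.Adj x v => hvx h.symm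
    have hvy' := fun h : G.Adj y v => hvy h.symm
    have hn' := fun h : G.Adj y x => hn h.symm
    have hix' := hix.symm
    have hiy' := hiy.symm
    fin_cases a <;> fin_cases b <;> simp [F4] <;> assumption

theorem stmt_4 (m : ℕ) (hm : 0 < m) {V : Type} [Fintype V] (G : SimpleGraph V)
    (hcard : Fintype.card V = m ^ 3) (hfree : IndFree F4 G) :
    ∃ s : Finset V, IsHomogeneous G s ∧ m ≤ s.card := by
  classical
  by_contra hcon
  push Not at hcon
  have hcl : ∀ K : Finset V, G.IsClique (K : Set V) → K.card ≤ m - 1 := fun K hK => by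
    have := hcon K (Or.inl hK); omega
  have hin : ∀ K : Finset V, Gᶜ.IsClique (K : Set V) → K.card ≤ m - 1 := fun K hK => by
    have := hcon K (Or.inr hK); omega
  have key := cover_aux G Finset.univ (m - 1) ((m - 1) * (m - 1)) (fun K _ => hcl K) (by
    intro v _
    apply cover_aux Gᶜ _ _ _ (fun K _ => hin K)
    intro i hi
    apply hcl
    intro x hx y hy hxy
    simp only [Finset.coe_filter, Finset.mem_filter, Finset.mem_univ, true_and,
      Set.mem_ofPred_eq, SimpleGraph.compl_adj, not_and, not_not] at hi hx hy
    by_cases h1 : i = x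
    · subst h1; exact hy.2 hxy
    by_cases h2 : i = y
    · subst h2; exact (hx.2 h1).symm
    exact f4_aux G hfree v i x y hi hx.1 hy.1 (hx.2 h1) (hy.2 h2) hxy)
  rw [Finset.card_univ, hcard] at key
  have : (m - 1) ^ 3 < m ^ 3 := Nat.pow_lt_pow_left (by omega) (by norm_num)
  nlinarith
end

section
/- Let G be a graph on n vertices and let s be an integer with 4 ≤ s < n. If every s-element vertex subset of G contains four vertices inducing a copy of F4, then G contains more than n^4/s^4 distinct induced copies of F4, i.e., more than n^4/s^4 four-element vertex subsets inducing a graph isomorphic to F4. -/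
open SimpleGraph

theorem aux_count {V : Type} [Fintype V] (P : Finset V → Prop) (s : ℕ)
    (hs : 4 ≤ s) (hsn : s < Fintype.card V)
    (h : ∀ t : Finset V, t.card = s → ∃ u ⊆ t, u.card = 4 ∧ P u) :
    (Fintype.card V).choose 4 ≤ {u : Finset V | u.card = 4 ∧ P u}.ncard * s.choose 4 := by
  classical
  set n := Fintype.card V with hn
  have e : {u : Finset V | u.card = 4 ∧ P u} =
      ((Finset.univ.filter fun u : Finset V => u.card = 4 ∧ P u : Finset (Finset V)) :
        Set (Finset V)) := by
    ext u; simp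
  rw [e, Set.ncard_coe_finset]
  set C := (Finset.univ.filter fun u : Finset V => u.card = 4 ∧ P u) with hC
  have h1 : n.choose s ≤ C.card * (n - 4).choose (s - 4) := by
    have a : (Finset.powersetCard s (Finset.univ : Finset V)) ⊆
        C.biUnion fun u => (Finset.powersetCard (s - 4) uᶜ).image fun w => u ∪ w := by
      intro t ht
      have ht' : t.card = s := (Finset.mem_powersetCard.1 ht).2
      obtain ⟨u, hu, hu4, hP⟩ := h t ht'
      refine Finset.mem_biUnion.2 ⟨u, by simp [hC, hu4, hP], ?_⟩
      refine Finset.mem_image.2 ⟨t \ u, ?_, Finset.union_sdiff_of_subset hu⟩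
      refine Finset.mem_powersetCard.2 ⟨?_, ?_⟩
      · intro x hx
        simp at hx ⊢
        exact hx.2
      · rw [Finset.card_sdiff_of_subset hu, ht', hu4]
    have b := Finset.card_le_card a
    rw [Finset.card_powersetCard, Finset.card_univ] at b
    refine b.trans (Finset.card_biUnion_le_card_mul _ _ _ ?_)
    intro u hu
    have hu4 : u.card = 4 := by
      have := (Finset.mem_filter.1 hu).2
      exact this.1
    refine Finset.card_image_le.trans ?_
    rw [Finset.card_powersetCard, Finset.card_compl, hu4]
  have h2 : n.choose s * s.choose 4 = n.choose 4 * (n - 4).choose (s - 4) :=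
    Nat.choose_mul hs
  have h3 : 0 < (n - 4).choose (s - 4) := Nat.choose_pos (by omega)
  refine Nat.le_of_mul_le_mul_right ?_ h3
  rw [← h2]
  calc _ ≤ _ := Nat.mul_le_mul_right (s.choose 4) h1
    _ = _ := by ring

theorem aux_choose (m : ℕ) : (((m + 4).choose 4 : ℕ) : ℝ) * 24 =
    ((m : ℝ) + 4) * (m + 3) * (m + 2) * (m + 1) := by
  have := Nat.descFactorial_eq_factorial_mul_choose (m + 4) 4
  simp [Nat.descFactorial, Nat.factorial] at this
  have h2 : (m + 4).choose 4 * 24 = (m + 4) * (m + 3) * (m + 2) * (m + 1) := by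
    rw [mul_comm, ← this]; ring
  exact_mod_cast h2

theorem stmt_6 {V : Type} [Fintype V] (G : SimpleGraph V) (s : ℕ)
    (hs : 4 ≤ s) (hsn : s < Fintype.card V)
    (h : ∀ t : Finset V, t.card = s →
      ∃ u ⊆ t, u.card = 4 ∧ Nonempty (F4 ≃g G.induce (u : Set V))) :
    ((Fintype.card V : ℝ) ^ 4) / (s : ℝ) ^ 4 <
      ({u : Finset V | u.card = 4 ∧ Nonempty (F4 ≃g G.induce (u : Set V))}.ncard : ℝ) := by
  have key := aux_count (fun u => Nonempty (F4 ≃g G.induce (u : Set V))) s hs hsn h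
  generalize {u : Finset V | u.card = 4 ∧ Nonempty (F4 ≃g G.induce (u : Set V))}.ncard = c at *
  generalize Fintype.card V = n at *
  clear h
  obtain ⟨a, rfl⟩ : ∃ a, s = a + 4 := ⟨s - 4, by omega⟩
  obtain ⟨b, rfl⟩ : ∃ b, n = b + 4 := ⟨n - 4, by omega⟩
  have hab : (a : ℝ) < b := by exact_mod_cast (by omega : a < b)
  have key' : (((b + 4).choose 4 : ℕ) : ℝ) ≤ c * ((a + 4).choose 4 : ℕ) := by exact_mod_cast key
  have k1 := aux_choose a
  have k2 := aux_choose b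
  have ha : (0 : ℝ) ≤ a := Nat.cast_nonneg a
  push_cast at *
  have q : ∀ i : ℝ, 0 < i → i < 4 → ((b : ℝ) + 4) / (a + 4) < (b + i) / (a + i) := by
    intro i hi hi4
    rw [div_lt_div_iff₀ (by positivity) (by positivity)]
    nlinarith
  have a0 : (0 : ℝ) < a + 4 := by positivity
  have b0 : (0 : ℝ) < b + 4 := by positivity
  have hr : (0 : ℝ) < ((b : ℝ) + 4) / (a + 4) := by positivity
  have e : ((b : ℝ) + 4) ^ 4 / (a + 4) ^ 4 = ((b : ℝ) + 4) / (a + 4) *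
    (((b : ℝ) + 4) / (a + 4)) * (((b : ℝ) + 4) / (a + 4)) * (((b : ℝ) + 4) / (a + 4)) := by
    field_simp
  rw [e]
  have q3 := q 3 (by norm_num) (by norm_num)
  have q2 := q 2 (by norm_num) (by norm_num)
  have q1 := q 1 (by norm_num) (by norm_num)
  calc _ < ((b : ℝ) + 4) / (a + 4) * ((b + 3) / (a + 3)) * ((b + 2) / (a + 2)) *
        ((b + 1) / (a + 1)) := by gcongr
    _ = ((b : ℝ) + 4) * (b + 3) * (b + 2) * (b + 1) /
        (((a : ℝ) + 4) * (a + 3) * (a + 2) * (a + 1)) := by field_simp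
    _ ≤ c := by
      rw [div_le_iff₀ (by positivity), ← k1, ← k2]
      nlinarith
end

section
/- Let G be a P5-free graph and let xy be an edge of G. Let N00 denote the set of vertices of G distinct from x and y adjacent to neither x nor y, and let N0|1 denote the set of vertices of G distinct from x and y adjacent to exactly one of x and y. Let C be a connected component of the induced subgraph G[N00] and let v ∈ N0|1. Then either v is adjacent to all vertices of C or v is adjacent to no vertex of C. -/
open SimpleGraph

theorem p5_aux {V : Type} (G : SimpleGraph V) (hP5 : P5Free G) (a b c d e : V)
    (hab : G.Adj a b) (hbc : G.Adj b c) (hcd : G.Adj c d) (hde : G.Adj d e)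
    (hac : ¬ G.Adj a c) (had : ¬ G.Adj a d) (hae : ¬ G.Adj a e)
    (hbd : ¬ G.Adj b d) (hbe : ¬ G.Adj b e) (hce : ¬ G.Adj c e) : False := by
  have hadj : ∀ i j : Fin 5, G.Adj (![a, b, c, d, e] i) (![a, b, c, d, e] j) ↔
      (pathGraph 5).Adj i j := by
    intro i j
    rw [pathGraph_adj]
    fin_cases i <;> fin_cases j <;>
      simp [hab, hbc, hcd, hde, hac, had, hae, hbd, hbe, hce, hab.symm, hbc.symm, hcd.symm,
        hde.symm, G.adj_comm c a, G.adj_comm d a, G.adj_comm e a, G.adj_comm d b,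
        G.adj_comm e b, G.adj_comm e c]
  have hinj : Function.Injective ![a, b, c, d, e] := by
    intro i j hij
    have key : ∀ k, (pathGraph 5).Adj i k ↔ (pathGraph 5).Adj j k := by
      intro k
      rw [← hadj, ← hadj, hij]
    simp only [pathGraph_adj] at key
    revert i j
    have : ∀ i j : Fin 5, (∀ k : Fin 5, (i.val + 1 = k.val ∨ k.val + 1 = i.val) ↔
      (j.val + 1 = k.val ∨ k.val + 1 = j.val)) → i = j := by decide
    intro i j _ key
    exact this i j key
  exact hP5 ⟨⟨⟨_, hinj⟩, fun {i j} => hadj i j⟩⟩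

theorem stmt_7 {V : Type} [Fintype V] (G : SimpleGraph V) (hP5 : P5Free G)
    (x y : V) (hxy : G.Adj x y) (v : V)
    (hvx : v ≠ x) (hvy : v ≠ y)
    (hv : (G.Adj v x ∧ ¬ G.Adj v y) ∨ (¬ G.Adj v x ∧ G.Adj v y))
    (C : (G.induce {w : V | w ≠ x ∧ w ≠ y ∧ ¬ G.Adj w x ∧ ¬ G.Adj w y}).ConnectedComponent) :
    (∀ u ∈ C.supp, G.Adj v u.1) ∨ (∀ u ∈ C.supp, ¬ G.Adj v u.1) := by
  have step : ∀ a b : {w : V | w ≠ x ∧ w ≠ y ∧ ¬ G.Adj w x ∧ ¬ G.Adj w y},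
      G.Adj a.1 b.1 → G.Adj v a.1 → G.Adj v b.1 := by
    rintro ⟨a, _, _, hax, hay⟩ ⟨b, _, _, hbx, hby⟩ hab hva
    by_contra hvb
    simp only at hab hva hvb
    rw [G.adj_comm] at hax hay hbx hby
    rcases hv with ⟨h1, h2⟩ | ⟨h1, h2⟩
    · exact p5_aux G hP5 y x v a b hxy.symm h1.symm hva hab
        (fun h => h2 h.symm) hay hby hax hbx hvb
    · exact p5_aux G hP5 x y v a b hxy h2.symm hva hab
        (fun h => h1 h.symm) hax hbx hay hby hvb
  by_cases h : ∃ u ∈ C.supp, G.Adj v u.1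
  · left
    obtain ⟨u, hu, hvu⟩ := h
    intro w hw
    obtain ⟨p⟩ := ConnectedComponent.exact (hu.trans hw.symm)
    clear hu hw
    induction p with
    | nil => exact hvu
    | cons hadj _ ih => exact ih (step _ _ hadj hvu)
  · right
    intro u hu hvu
    exact h ⟨u, hu, hvu⟩
end

section
/- Let f : ℕ → ℝ≥0 be a concave and increasing function, and let G be a graph on s vertices whose vertex set is partitioned into r nonempty parts, each of size at most a (where a is a positive integer), such that either every pair of vertices from different parts is adjacent or every pair of vertices from different parts is non-adjacent. Assume that for every s' ≤ s, every s'-element vertex subset of G contains an induced cograph on at least f(s') vertices. Then G contains an induced cograph on at least ⌊s/a⌋·f(a) vertices. -/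
open SimpleGraph

theorem aux_conc_step (f : ℕ → ℝ) (hf0 : ∀ n : ℕ, 0 ≤ f n)
    (hconc : ∀ i : ℕ, 1 ≤ i → f (i + 1) - f i ≤ f i - f (i - 1)) (n : ℕ) :
    (n : ℝ) * f (n + 1) ≤ ((n : ℝ) + 1) * f n := by
  induction n with
  | zero => simpa using hf0 0
  | succ n ih =>
    have h := hconc (n + 1) (by omega)
    simp only [Nat.add_sub_cancel] at h
    push_cast
    have hn : (0 : ℝ) ≤ n := Nat.cast_nonneg n
    nlinarith

theorem aux_conc (f : ℕ → ℝ) (hf0 : ∀ n : ℕ, 0 ≤ f n)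
    (hconc : ∀ i : ℕ, 1 ≤ i → f (i + 1) - f i ≤ f i - f (i - 1)) (k a : ℕ) (hk : k ≤ a) :
    (k : ℝ) * f a ≤ (a : ℝ) * f k := by
  induction a, hk using Nat.le_induction with
  | base => exact le_rfl
  | succ a hka ih =>
    rcases Nat.eq_zero_or_pos a with h0 | hpos
    · subst h0
      obtain rfl : k = 0 := by omega
      simpa using hf0 0
    · have h := aux_conc_step f hf0 hconc a
      have hp : (0 : ℝ) < a := by exact_mod_cast hpos
      have hk0 : (0 : ℝ) ≤ k := Nat.cast_nonneg k
      have h1 := mul_le_mul_of_nonneg_left h hk0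
      have h2 := mul_le_mul_of_nonneg_left ih (by positivity : (0 : ℝ) ≤ (a : ℝ) + 1)
      push_cast
      refine le_of_mul_le_mul_left ?_ hp
      linarith

theorem stmt_10 {V : Type} [Fintype V] (G : SimpleGraph V)
    (f : ℕ → ℝ) (hf0 : ∀ n : ℕ, 0 ≤ f n) (hmono : Monotone f)
    (hconc : ∀ i : ℕ, 1 ≤ i → f (i + 1) - f i ≤ f i - f (i - 1))
    (r a : ℕ) (ha : 0 < a) (P : Fin r → Finset V)
    (hne : ∀ i, (P i).Nonempty)
    (hdisj : ∀ i j, i ≠ j → Disjoint (P i) (P j))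
    (hcover : ∀ v : V, ∃ i, v ∈ P i)
    (hsize : ∀ i, (P i).card ≤ a)
    (hpure : (∀ i j, i ≠ j → ∀ u ∈ P i, ∀ w ∈ P j, G.Adj u w) ∨
             (∀ i j, i ≠ j → ∀ u ∈ P i, ∀ w ∈ P j, ¬ G.Adj u w))
    (hsub : ∀ t : Finset V, ∃ u ⊆ t, IsCographSet G u ∧ f t.card ≤ (u.card : ℝ)) :
    ∃ u : Finset V, IsCographSet G u ∧
      ((Fintype.card V / a : ℕ) : ℝ) * f a ≤ (u.card : ℝ) := by
  classical
  choose u hut huc huf using fun i => hsub (P i)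
  choose p hp using hcover
  have hpu : ∀ i v, v ∈ P i → p v = i := by
    intro i v hv
    by_contra hne'
    exact Finset.disjoint_left.1 (hdisj _ _ hne') (hp v) hv
  refine ⟨Finset.univ.biUnion u, ?_, ?_⟩
  · rintro ⟨e⟩
    have hmem : ∀ k, (e k : V) ∈ u (p (e k : V)) := by
      intro k
      have h := (e k).2
      simp only [Finset.coe_biUnion, Set.mem_iUnion] at h
      obtain ⟨i, -, hi⟩ := h
      have hi' : (e k : V) ∈ u i := hi
      rw [hpu i _ (hut i hi')]
      exact hi'
    have hadj : ∀ k l, G.Adj (e k : V) (e l : V) ↔ (pathGraph 4).Adj k l := by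
      intro k l
      have := e.map_rel_iff (a := k) (b := l)
      simpa using this
    have hsame : ∀ k, p (e k : V) = p (e 0 : V) := by
      rcases hpure with h | h
      · have key : ∀ k l, ¬ (pathGraph 4).Adj k l → p (e k : V) = p (e l : V) := by
          intro k l hkl
          by_contra hc
          exact hkl ((hadj k l).1 (h _ _ hc _ (hp _) _ (hp _)))
        have h1 := key 2 0 (by simp [pathGraph_adj])
        have h2 := key 3 0 (by simp [pathGraph_adj])
        have h3 := key 1 3 (by simp [pathGraph_adj])
        intro k
        fin_cases k
        · rfl
        · exact h3.trans h2
        · exact h1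
        · exact h2
      · have key : ∀ k l, (pathGraph 4).Adj k l → p (e k : V) = p (e l : V) := by
          intro k l hkl
          by_contra hc
          exact h _ _ hc _ (hp _) _ (hp _) ((hadj k l).2 hkl)
        have h1 := key 1 0 (by simp [pathGraph_adj])
        have h2 := key 2 1 (by simp [pathGraph_adj])
        have h3 := key 3 2 (by simp [pathGraph_adj])
        intro k
        fin_cases k
        · rfl
        · exact h1
        · exact h2.trans h1
        · exact h3.trans (h2.trans h1)
    refine huc (p (e 0 : V)) ⟨⟨⟨fun k => ⟨(e k : V), ?_⟩, ?_⟩, ?_⟩⟩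
    · have := hmem k
      rw [hsame k] at this
      exact this
    · intro k l hkl
      have h := Subtype.ext_iff.1 hkl
      exact e.injective (Subtype.ext h)
    · intro k l
      exact hadj k l
  · have hd : ∀ i ∈ (Finset.univ : Finset (Fin r)), ∀ j ∈ (Finset.univ : Finset (Fin r)),
        i ≠ j → Disjoint (u i) (u j) := fun i _ j _ hij =>
      Finset.disjoint_of_subset_left (hut i) (Finset.disjoint_of_subset_right (hut j) (hdisj i j hij))
    have hcard : Fintype.card V = ∑ i, (P i).card := by
      rw [← Finset.card_biUnion (fun i _ j _ hij => hdisj i j hij), ← Finset.card_univ]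
      congr 1
      ext v
      simpa using ⟨p v, hp v⟩
    rw [Finset.card_biUnion hd]
    push_cast
    have hap : (0 : ℝ) < a := by exact_mod_cast ha
    refine le_of_mul_le_mul_left ?_ hap
    have hdiv : (a : ℝ) * ((Fintype.card V / a : ℕ) : ℝ) ≤ (Fintype.card V : ℝ) := by
      exact_mod_cast Nat.mul_div_le _ _
    calc (a : ℝ) * (((Fintype.card V / a : ℕ) : ℝ) * f a)
        = ((a : ℝ) * ((Fintype.card V / a : ℕ) : ℝ)) * f a := by ring
      _ ≤ (Fintype.card V : ℝ) * f a := mul_le_mul_of_nonneg_right hdiv (hf0 a)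
      _ = ∑ i, ((P i).card : ℝ) * f a := by
          rw [hcard]; push_cast; rw [Finset.sum_mul]
      _ ≤ ∑ i, (a : ℝ) * ((u i).card : ℝ) := Finset.sum_le_sum fun i _ =>
          (aux_conc f hf0 hconc _ a (hsize i)).trans
            (mul_le_mul_of_nonneg_left (huf i) hap.le)
      _ = (a : ℝ) * ∑ i, ((u i).card : ℝ) := by rw [Finset.mul_sum]
end

section
/- Let G be a P5-free graph and let (A,B) be a good pair in G that is maximum in the lexicographic sense: for every good pair (A',B') in G, either |A'| < |A|, or |A'| = |A| and |B'| ≤ |B|. Then every vertex v of G outside A ∪ B that is anticomplete to A or anticomplete to B is anticomplete to A ∪ B. -/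
open SimpleGraph

/-- `(A, B)` is a good pair: both parts nonempty and disjoint, anticomplete to each other,
both inducing connected subgraphs, and `|A| ≤ |B|`. -/
def IsGoodPair {V : Type*} (G : SimpleGraph V) (A B : Finset V) : Prop :=
  A.Nonempty ∧ B.Nonempty ∧ Disjoint A B ∧
  (∀ a ∈ A, ∀ b ∈ B, ¬ G.Adj a b) ∧
  (G.induce (A : Set V)).Connected ∧ (G.induce (B : Set V)).Connected ∧
  A.card ≤ B.card

theorem conn_insert_aux {V : Type} [DecidableEq V] (G : SimpleGraph V) (A : Finset V)
    (hA : (G.induce (A : Set V)).Connected) (v u : V) (hu : u ∈ A) (h : G.Adj v u) :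
    (G.induce ((insert v A : Finset V) : Set V)).Connected := by
  have h1 : (G.induce ({v, u} : Set V)).Connected := induce_pair_connected_of_adj h
  have h2 := induce_union_connected hA.preconnected h1.preconnected ⟨u, by simpa using hu, by simp⟩
  have e : ((insert v A : Finset V) : Set V) = (A : Set V) ∪ {v, u} := by
    ext x
    simp only [Finset.coe_insert, Set.mem_insert_iff, Finset.mem_coe, Set.mem_union,
      Set.mem_singleton_iff]
    constructor
    · tauto
    · rintro (h | h | h)
      · exact Or.inr h
      · exact Or.inl h
      · exact Or.inr (h ▸ hu)
  rw [e]
  exact h2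

theorem stmt_14 {V : Type} [Fintype V] [DecidableEq V] (G : SimpleGraph V) (hP5 : P5Free G)
    (A B : Finset V) (hgood : IsGoodPair G A B)
    (hmax : ∀ A' B' : Finset V, IsGoodPair G A' B' →
      A'.card < A.card ∨ (A'.card = A.card ∧ B'.card ≤ B.card))
    (v : V) (hv : v ∉ A ∪ B)
    (hanti : (∀ a ∈ A, ¬ G.Adj v a) ∨ (∀ b ∈ B, ¬ G.Adj v b)) :
    ∀ u ∈ A ∪ B, ¬ G.Adj v u := by
  obtain ⟨hAn, hBn, hd, hab, hA, hB, hc⟩ := hgood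
  rw [Finset.mem_union, not_or] at hv
  obtain ⟨hvA, hvB⟩ := hv
  intro u hu hadj
  rw [Finset.mem_union] at hu
  rcases hanti with h | h
  · have huB : u ∈ B := hu.resolve_left fun hh => h u hh hadj
    have key := hmax A (insert v B) ⟨hAn, Finset.insert_nonempty _ _,
      Finset.disjoint_insert_right.2 ⟨hvA, hd⟩, ?_, hA, conn_insert_aux G B hB v u huB hadj, ?_⟩
    · rw [Finset.card_insert_of_notMem hvB] at key
      omega
    · intro a ha b hb
      rcases Finset.mem_insert.1 hb with rfl | hb
      · exact fun e => h a ha e.symm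
      · exact hab a ha b hb
    · rw [Finset.card_insert_of_notMem hvB]
      omega
  · have huA : u ∈ A := hu.resolve_right fun hh => h u hh hadj
    have hac : ∀ a ∈ insert v A, ∀ b ∈ B, ¬ G.Adj a b := by
      intro a ha b hb
      rcases Finset.mem_insert.1 ha with rfl | ha
      · exact h b hb
      · exact hab a ha b hb
    have hcon := conn_insert_aux G A hA v u huA hadj
    have hdis : Disjoint (insert v A) B := Finset.disjoint_insert_left.2 ⟨hvB, hd⟩
    have hcard := Finset.card_insert_of_notMem hvA
    rcases Nat.lt_or_ge A.card B.card with hlt | hge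
    · have key := hmax (insert v A) B ⟨Finset.insert_nonempty _ _, hBn, hdis, hac, hcon, hB,
        by omega⟩
      omega
    · have key := hmax B (insert v A) ⟨hBn, Finset.insert_nonempty _ _, hdis.symm,
        fun b hb a ha e => hac a ha b hb e.symm, hB, hcon, by omega⟩
      omega
end
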